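/- Let k be a field of characteristic p > 0 and let A = k[x]. The first Weyl algebra A_1(k), realized as the k-subalgebra of End_k(A) generated by the multiplication operator x and the divided power operators ∂^[r] for r ≥ 1, has left global dimension one; in particular A_1(k) is left semi-hereditary and hence a coherent ring. -/

import Mathlib

/-- The divided power operator `∂_i^[r]` on `k[x_1,…,x_n]`, the `k`-linear map determined on
monomials by `∂_i^[r](x^m) = C(m_i, r) • x^(m - r·ε_i)` (zero when `m_i < r`). -/
noncomputable def dividedPower (k : Type*) [Field k] (n : ℕ) (i : Fin n) (r : ℕ) :
    Module.End k (MvPolynomial (Fin n) k) :=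
  (MvPolynomial.basisMonomials (Fin n) k).constr k fun m =>
    ((m i).choose r : k) • MvPolynomial.monomial (m - Finsupp.single i r) 1

/-- The Weyl algebra `A_n(k)`, the `k`-subalgebra of `End_k(k[x_1,…,x_n])` generated by the
multiplication operators by `x_1,…,x_n` together with all divided powers `∂_i^[r]`, `r ≥ 1`. -/
noncomputable def weylAlgebra (k : Type*) [Field k] (n : ℕ) :
    Subalgebra k (Module.End k (MvPolynomial (Fin n) k)) :=
  Algebra.adjoin k
    ((Set.range fun i : Fin n => (LinearMap.mulLeft k (MvPolynomial.X i) :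
        Module.End k (MvPolynomial (Fin n) k))) ∪
      {f | ∃ (i : Fin n) (r : ℕ), 1 ≤ r ∧ f = dividedPower k n i r})

/-- A ring is left coherent if every finitely generated left ideal is finitely presented. -/
def IsLeftCoherent (R : Type*) [Ring R] : Prop :=
  ∀ I : Ideal R, I.FG → Module.FinitePresentation R I

/-- A ring is right coherent if every finitely generated right ideal is finitely presented. -/
def IsRightCoherent (R : Type*) [Ring R] : Prop :=
  ∀ I : Ideal Rᵐᵒᵖ, I.FG → Module.FinitePresentation Rᵐᵒᵖ I

/-- The subalgebra `A_r = k[x_1^{p^r},…,x_n^{p^r}]` of `A = k[x_1,…,x_n]`. -/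
noncomputable def subAr (k : Type*) [Field k] (n p r : ℕ) :
    Subalgebra k (MvPolynomial (Fin n) k) :=
  Algebra.adjoin k (Set.range fun i : Fin n => MvPolynomial.X i ^ p ^ r)

/-- The ring `D_r = End_{A_r}(A)` of `A_r`-module endomorphisms of `A`, viewed as the subring of
`End_k(A)` of endomorphisms commuting with multiplication by elements of `A_r`. -/
noncomputable def endAr (k : Type*) [Field k] (n p r : ℕ) :
    Subring (Module.End k (MvPolynomial (Fin n) k)) :=
  Subring.centralizer
    ((fun b => (LinearMap.mulLeft k b : Module.End k (MvPolynomial (Fin n) k))) ''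
      (subAr k n p r : Set (MvPolynomial (Fin n) k)))

/-- A module which is the union of a chain of submodules starting at `⊥`, each of which is a direct
summand of the next one with projective complement, is projective. -/
theorem Module.Projective.of_chain {R M : Type*} [Ring R] [AddCommGroup M] [Module R M]
    (Q C : ℕ → Submodule R M) (hzero : Q 0 = ⊥) (htop : ∀ x, ∃ n, x ∈ Q n)
    (hdisj : ∀ n, Disjoint (Q n) (C n)) (hsup : ∀ n, Q n ⊔ C n = Q (n + 1))
    [∀ n, Module.Projective R (C n)] : Module.Projective R M := by
  have hle : ∀ n, Q n ≤ Q (n + 1) := fun n => hsup n ▸ le_sup_left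
  have hmem : ∀ n (c : ∀ i, C i), ∑ i ∈ Finset.range n, (c i : M) ∈ Q n := by
    intro n c
    induction n with
    | zero => simp
    | succ n ih =>
      rw [Finset.sum_range_succ, ← hsup]
      exact Submodule.add_mem_sup ih (c n).2
  have hzero' : ∀ n (c : ∀ i, C i), ∑ i ∈ Finset.range n, (c i : M) = 0 →
      ∀ i < n, (c i : M) = 0 := by
    intro n c
    induction n with
    | zero => simp
    | succ n ih =>
      intro h
      rw [Finset.sum_range_succ] at h
      have h1 : (c n : M) ∈ Q n := by
        rw [eq_neg_of_add_eq_zero_right h]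
        exact neg_mem (hmem n c)
      have h2 : (c n : M) = 0 := Submodule.disjoint_def.1 (hdisj n) _ h1 (c n).2
      rw [h2, add_zero] at h
      intro i hi
      rcases Nat.lt_succ_iff_lt_or_eq.1 hi with hi | rfl
      · exact ih h i hi
      · exact h2
  let φ : (Π₀ n, C n) →ₗ[R] M := DFinsupp.lsum ℕ fun n => (C n).subtype
  have hinj : Function.Injective φ := by
    rw [← LinearMap.ker_eq_bot, LinearMap.ker_eq_bot']
    intro f hf
    classical
    obtain ⟨n, hn⟩ := f.support.exists_nat_subset_range
    have hs : φ f = ∑ i ∈ Finset.range n, (f i : M) := by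
      simp only [φ, DFinsupp.lsum_apply_apply, DFinsupp.sumAddHom_apply]
      refine Finset.sum_subset hn fun i _ hi => ?_
      simp [DFinsupp.notMem_support_iff.1 hi]
    ext i
    by_cases hi : i < n
    · exact hzero' n f (hs ▸ hf) i hi
    · simp [DFinsupp.notMem_support_iff.1 fun h => hi (Finset.mem_range.1 (hn h))]
  have hrange : ∀ n, Q n ≤ LinearMap.range φ := by
    intro n
    induction n with
    | zero => simp [hzero]
    | succ n ih =>
      rw [← hsup]
      refine sup_le ih fun x hx => ⟨DFinsupp.single n ⟨x, hx⟩, ?_⟩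
      simp [φ]
  have hsurj : Function.Surjective φ := fun x => (htop x).elim fun n hn => hrange n hn
  exact Module.Projective.of_equiv (LinearEquiv.ofBijective φ ⟨hinj, hsurj⟩)

/-- If every left ideal of a ring is projective, so is every submodule of a projective module. -/
theorem Submodule.projective_of_projective_ideals {R : Type*} [Ring R]
    (hR : ∀ I : Ideal R, Module.Projective R I) {M : Type*} [AddCommGroup M] [Module R M]
    [Module.Projective R M] (N : Submodule R M) : Module.Projective R N := by
  let π : (N →₀ R) →ₗ[R] N := Finsupp.linearCombination R id
  have hπ : Function.Surjective π := Finsupp.linearCombination_surjective _ Function.surjective_id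
  obtain ⟨⟨J, hJ, i, hi⟩⟩ := (ModuleCat.enoughInjectives (R := R)).presentation
    (ModuleCat.of R (N →₀ R))
  have hJB : Module.Baer R J :=
    Module.Baer.of_injective ((Module.injective_iff_injective_object R J).2 hJ)
  have hi' : Function.Injective i.hom := (ModuleCat.mono_iff_injective i).1 hi
  let K : Submodule R J := (LinearMap.ker π).map i.hom
  have hKB : Module.Baer R (J ⧸ K) := by
    intro I g
    obtain ⟨g', hg'⟩ := Module.projective_lifting_property K.mkQ g K.mkQ_surjective
    obtain ⟨h, hh⟩ := hJB I g'
    exact ⟨K.mkQ ∘ₗ h, fun x hx => by simp [hh x hx, ← hg']⟩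
  let f : N →ₗ[R] J ⧸ K :=
    (LinearMap.ker π).liftQ (K.mkQ ∘ₗ i.hom) (fun x hx => by
      simpa [K] using Submodule.mem_map_of_mem (f := i.hom) hx) ∘ₗ
      (π.quotKerEquivOfSurjective hπ).symm.toLinearMap
  have hf : ∀ x, f (π x) = K.mkQ (i.hom x) := by
    intro x
    have : (π.quotKerEquivOfSurjective hπ).symm (π x) = (LinearMap.ker π).mkQ x := by
      rw [LinearEquiv.symm_apply_eq]; rfl
    simp only [f, LinearMap.comp_apply, LinearEquiv.coe_coe, this]
    simp
  obtain ⟨F, hF⟩ := hKB.extension_property N.subtype N.injective_subtype f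
  obtain ⟨G, hG⟩ := Module.projective_lifting_property K.mkQ F K.mkQ_surjective
  have hmem : ∀ x : N, G x ∈ LinearMap.range i.hom := by
    intro x
    obtain ⟨y, rfl⟩ := hπ x
    have h1 : K.mkQ (G (π y)) = K.mkQ (i.hom y) := by
      rw [← hf, ← hF, ← hG]; rfl
    obtain ⟨z, -, hz⟩ := (Submodule.Quotient.eq K).1 h1
    exact ⟨z + y, by simp [hz]⟩
  let s : N →ₗ[R] (N →₀ R) := (LinearEquiv.ofInjective i.hom hi').symm.toLinearMap ∘ₗ
    (G ∘ₗ N.subtype).codRestrict _ hmem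
  have hs : ∀ x, i.hom (s x) = G x := fun x =>
    congrArg Subtype.val ((LinearEquiv.ofInjective i.hom hi').apply_symm_apply ⟨G x, hmem x⟩)
  refine Module.Projective.of_split s π (LinearMap.ext fun x => ?_)
  obtain ⟨y, rfl⟩ := hπ x
  have h1 : K.mkQ (i.hom (s (π y))) = K.mkQ (i.hom y) := by
    rw [hs, ← hf, ← hF, ← hG]; rfl
  obtain ⟨z, hz, hz'⟩ := (Submodule.Quotient.eq K).1 h1
  rw [← map_sub] at hz'
  have := hi' hz'
  subst this
  simpa [sub_eq_zero] using hz

/-- A left ideal is projective if it is the union of an increasing sequence of finitely generated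
left ideals, each cut out by a right multiplication, over a left semi-hereditary ring. -/
theorem Ideal.projective_of_chain {R : Type*} [Ring R]
    (hR : ∀ I : Ideal R, I.FG → Module.Projective R I) (I : Ideal R) (u : ℕ → R)
    (hmono : ∀ n, ∀ d ∈ I, d * u n = 0 → d * u (n + 1) = 0) (hzero : u 0 = 1)
    (htop : ∀ d ∈ I, ∃ n, d * u n = 0)
    (hfg : ∀ n, ∃ J : Ideal R, J.FG ∧ ∀ d, d ∈ J ↔ d ∈ I ∧ d * u n = 0) :
    Module.Projective R I := by
  let Q : ℕ → Submodule R I := fun n =>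
    LinearMap.ker (LinearMap.toSpanSingleton R R (u n) ∘ₗ I.subtype)
  have hQ : ∀ n (x : I), x ∈ Q n ↔ (x : R) * u n = 0 := fun n x => by simp [Q]
  have hQle : ∀ n, Q n ≤ Q (n + 1) := fun n x hx =>
    (hQ _ _).2 (hmono n x x.2 ((hQ _ _).1 hx))
  have hC : ∀ n, ∃ C : Submodule R I, Module.Projective R C ∧ Disjoint (Q n) C ∧
      Q n ⊔ C = Q (n + 1) := by
    intro n
    let f : Q (n + 1) →ₗ[R] R :=
      LinearMap.toSpanSingleton R R (u n) ∘ₗ I.subtype ∘ₗ (Q (n + 1)).subtype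
    have hfgQ : (Q (n + 1)).FG := by
      refine Submodule.fg_of_fg_map_injective I.subtype I.injective_subtype ?_
      obtain ⟨J, hJ, hmem⟩ := hfg (n + 1)
      have : (Q (n + 1)).map I.subtype = J := by
        ext x
        simp [hQ, hmem, and_comm]
      rwa [this]
    have := Module.Finite.of_fg hfgQ
    have : Module.Projective R (LinearMap.range f) := hR _ (Module.Finite.iff_fg.1 inferInstance)
    obtain ⟨s, hs⟩ := f.rangeRestrict.exists_rightInverse_of_surjective f.range_rangeRestrict
    have hs' : ∀ y, f (s y) = y := fun y => congrArg Subtype.val (LinearMap.congr_fun hs y)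
    have hfQ : ∀ x, f x = 0 ↔ (x : I) ∈ Q n := fun x => by simp [hQ, f]
    let t : LinearMap.range f →ₗ[R] I := (Q (n + 1)).subtype ∘ₗ s
    have ht : Function.Injective t := fun a b hab =>
      Subtype.ext (by rw [← hs' a, ← hs' b, Subtype.ext (p := (· ∈ Q (n + 1))) hab])
    refine ⟨LinearMap.range t, Module.Projective.of_equiv (LinearEquiv.ofInjective t ht), ?_, ?_⟩
    · rw [Submodule.disjoint_def]
      rintro _ hx ⟨y, rfl⟩
      have := hs' y
      rw [(hfQ _).2 hx] at this
      rw [show y = 0 from Subtype.ext this.symm, map_zero]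
    · refine le_antisymm (sup_le (hQle n) ?_) fun x hx => ?_
      · rintro _ ⟨y, rfl⟩
        exact (s y).2
      · let y : LinearMap.range f := ⟨f ⟨x, hx⟩, ⟨x, hx⟩, rfl⟩
        have : (x - t y) ∈ Q n :=
          (hfQ (⟨x, hx⟩ - s y)).1 (by rw [map_sub, hs']; exact sub_self _)
        simpa using Submodule.add_mem_sup this (LinearMap.mem_range_self t y)
  choose C hCp hCd hCs using hC
  refine Module.Projective.of_chain Q C ?_ (fun x => ?_) hCd hCs
  · ext x
    simp [hQ, hzero]
  · obtain ⟨n, hn⟩ := htop x x.2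
    exact ⟨n, (hQ n x).2 hn⟩

/-- A left Bézout ring in which the left annihilator of every element is that of an idempotent is
left semi-hereditary. -/
theorem Ideal.projective_of_fg_of_bezout {R : Type*} [Ring R]
    (hb : ∀ a b : R, ∃ c u v w z, c = u * a + v * b ∧ a = w * c ∧ b = z * c)
    (he : ∀ a : R, ∃ e, e * e = e ∧ ∀ b, b * a = 0 ↔ b * e = 0) (I : Ideal R) (hI : I.FG) :
    Module.Projective R I := by
  have hprin : ∃ a, I = Submodule.span R {a} := by
    induction I, hI using Submodule.fg_induction with
    | singleton x => exact ⟨x, rfl⟩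
    | sup _ _ _ _ h₁ h₂ =>
      obtain ⟨a, rfl⟩ := h₁
      obtain ⟨b, rfl⟩ := h₂
      obtain ⟨c, u, v, w, z, hc, ha, hb⟩ := hb a b
      refine ⟨c, le_antisymm (sup_le ?_ ?_) ?_⟩ <;>
        rw [Submodule.span_singleton_le_iff_mem]
      · exact Submodule.mem_span_singleton.2 ⟨w, ha.symm⟩
      · exact Submodule.mem_span_singleton.2 ⟨z, hb.symm⟩
      · rw [hc]
        exact Submodule.add_mem_sup (Submodule.mem_span_singleton.2 ⟨u, rfl⟩)
          (Submodule.mem_span_singleton.2 ⟨v, rfl⟩)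
  obtain ⟨a, rfl⟩ := hprin
  obtain ⟨e, hee, he⟩ := he a
  have hker : LinearMap.ker (LinearMap.toSpanSingleton R R a) =
      LinearMap.ker (LinearMap.toSpanSingleton R R e) := by
    ext b
    simpa using he b
  have hproj : Module.Projective R (LinearMap.range (LinearMap.toSpanSingleton R R e)) := by
    refine Module.Projective.of_split (Submodule.subtype _)
      (LinearMap.toSpanSingleton R R e).rangeRestrict (LinearMap.ext ?_)
    rintro ⟨_, y, rfl⟩
    ext
    simp [mul_assoc, hee]
  rw [← LinearMap.range_toSpanSingleton]
  exact Module.Projective.of_equiv <|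
    (LinearMap.quotKerEquivRange (LinearMap.toSpanSingleton R R e)).symm.trans <|
    (Submodule.quotEquivOfEq _ _ hker.symm).trans
      (LinearMap.quotKerEquivRange (LinearMap.toSpanSingleton R R a))

namespace Matrix

variable {n R : Type*} [Fintype n] [DecidableEq n] [CommRing R]

/-- The submodule of the vectors which occur as rows of elements of a left ideal of matrices. -/
def rowSubmodule (I : Ideal (Matrix n n R)) : Submodule R (n → R) where
  carrier := {v | ∀ w, vecMulVec w v ∈ I}
  add_mem' hv hv' w := by
    rw [vecMulVec_add]
    exact add_mem (hv w) (hv' w)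
  zero_mem' w := by simp
  smul_mem' r v hv w := by
    rw [vecMulVec_smul, ← smul_vecMulVec]
    exact hv _

theorem mem_iff_row_mem_rowSubmodule {I : Ideal (Matrix n n R)} {d : Matrix n n R} :
    d ∈ I ↔ ∀ i, d i ∈ rowSubmodule I := by
  refine ⟨fun hd i w => ?_, fun h => ?_⟩
  · have : vecMulVec w (d i) = vecMulVec w (Pi.single i 1) * d := by
      rw [vecMulVec_mul, single_one_vecMul]; rfl
    rw [this]
    exact I.mul_mem_left _ hd
  · have : d = ∑ i, vecMulVec (Pi.single i 1) (d i) := by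
      ext a b
      simp [sum_apply, vecMulVec_apply, Pi.single_apply]
    rw [this]
    exact sum_mem fun i _ => h i _

variable [IsDomain R] [IsPrincipalIdealRing R]

/-- Left ideals of a matrix ring over a principal ideal domain are principal. -/
theorem exists_generator (I : Ideal (Matrix n n R)) : ∃ a ∈ I, ∀ d ∈ I, ∃ w, d = w * a := by
  let H := rowSubmodule I
  have hcard : Module.finrank R H ≤ Fintype.card n := by
    simpa using Submodule.finrank_le H
  let b := Module.finBasis R H
  let j : Fin (Module.finrank R H) ↪ n :=
    (Fin.castLEEmb hcard).trans (Fintype.equivFin n).symm.toEmbedding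
  let a : Matrix n n R := fun i => Function.extend j (fun l => (b l : n → R)) 0 i
  have ha : ∀ l, a (j l) = b l := fun l => j.injective.extend_apply _ _ _
  refine ⟨a, mem_iff_row_mem_rowSubmodule.2 fun i => ?_, fun d hd => ?_⟩
  · by_cases hi : ∃ l, j l = i
    · obtain ⟨l, rfl⟩ := hi
      rw [ha]
      exact (b l).2
    · have : a i = 0 := Function.extend_apply' _ _ _ hi
      rw [this]
      exact zero_mem _
  · have hd' : ∀ i, ∃ w : n → R, d i = w ᵥ* a := by
      intro i
      let v : H := ⟨d i, mem_iff_row_mem_rowSubmodule.1 hd i⟩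
      refine ⟨∑ l, Pi.single (j l) (b.repr v l), ?_⟩
      have h1 : d i = ∑ l, b.repr v l • (b l : n → R) := by
        have := congrArg H.subtype (b.sum_repr v)
        simp only [map_sum, map_smul, Submodule.subtype_apply] at this
        exact this.symm
      rw [h1, sum_vecMul]
      refine Finset.sum_congr rfl fun l _ => ?_
      rw [single_vecMul, ← ha]
      rfl
    choose w hw using hd'
    exact ⟨w, funext fun i => by rw [hw i]; rfl⟩

/-- A left ideal of a matrix ring over a principal ideal domain has a right unit `e` in the matrix
ring which is idempotent and lies in the ideal after multiplication by a nonzero scalar. -/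
theorem exists_idempotent_rightUnit (I : Ideal (Matrix n n R)) :
    ∃ e : Matrix n n R, e * e = e ∧ (∀ d ∈ I, d * e = d) ∧ ∃ r : R, r ≠ 0 ∧ r • e ∈ I := by
  let H := rowSubmodule I
  let N := (n → R) ⧸ H
  let f : (n → R) →ₗ[R] N ⧸ Submodule.torsion R N := (Submodule.torsion R N).mkQ ∘ₗ H.mkQ
  have hf : Function.Surjective f :=
    (Submodule.mkQ_surjective _).comp (Submodule.mkQ_surjective _)
  obtain ⟨s, hs⟩ := f.exists_rightInverse_of_surjective (LinearMap.range_eq_top.2 hf)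
  have hs' : ∀ y, f (s y) = y := fun y => LinearMap.congr_fun hs y
  let π : (n → R) →ₗ[R] (n → R) := LinearMap.id - s ∘ₗ f
  have hπ : ∀ v, π v = v - s (f v) := fun v => rfl
  have hfπ : ∀ v, f (π v) = 0 := fun v => by rw [hπ, map_sub, hs', sub_self]
  have hππ : ∀ v, π (π v) = π v := fun v => by rw [hπ (π v), hfπ, map_zero, sub_zero]
  have hπH : ∀ v ∈ H, π v = v := by
    intro v hv
    have : f v = 0 := by
      simp only [f, LinearMap.comp_apply]
      rw [show H.mkQ v = 0 from (Submodule.Quotient.mk_eq_zero H).2 hv, map_zero]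
    rw [hπ, this, map_zero, sub_zero]
  let e : Matrix n n R := LinearMap.toMatrixRight' π
  have he : ∀ v, v ᵥ* e = π v := fun v =>
    LinearMap.congr_fun (LinearMap.toMatrixRight'.symm_apply_apply π) v
  have hrow : ∀ d : Matrix n n R, ∀ i, (d * e) i = π (d i) := fun d i => by
    rw [← he]; rfl
  have hei : ∀ i, e i = π (Pi.single i 1) := fun i => by
    rw [← he, single_one_vecMul]; rfl
  refine ⟨e, funext fun i => ?_, fun d hd => funext fun i => ?_, ?_⟩
  · rw [hrow, hei, hππ]
  · rw [hrow, hπH _ (mem_iff_row_mem_rowSubmodule.1 hd i)]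
  · have htors : ∀ i, ∃ r : R, r ≠ 0 ∧ r • e i ∈ H := by
      intro i
      have h1 : H.mkQ (e i) ∈ Submodule.torsion R N := by
        rw [← Submodule.Quotient.mk_eq_zero, hei]
        exact hfπ _
      obtain ⟨⟨r, hr⟩, h⟩ := h1
      exact ⟨r, nonZeroDivisors.ne_zero hr, (Submodule.Quotient.mk_eq_zero H).1 h⟩
    choose r hr hrH using htors
    refine ⟨∏ i, r i, Finset.prod_ne_zero_iff.2 fun i _ => hr i,
      mem_iff_row_mem_rowSubmodule.2 fun i => ?_⟩
    change (∏ i, r i) • e i ∈ H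
    rw [← Finset.prod_erase_mul _ _ (Finset.mem_univ i), mul_smul]
    exact H.smul_mem _ (hrH i)

theorem exists_left_bezout (a b : Matrix n n R) :
    ∃ c u v w z, c = u * a + v * b ∧ a = w * c ∧ b = z * c := by
  obtain ⟨c, hc, h⟩ := exists_generator (Ideal.span {a, b})
  obtain ⟨u, v, huv⟩ := Ideal.mem_span_pair.1 hc
  obtain ⟨w, hw⟩ := h a (Ideal.subset_span (by simp))
  obtain ⟨z, hz⟩ := h b (Ideal.subset_span (by simp))
  exact ⟨c, u, v, w, z, huv.symm, hw, hz⟩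

theorem exists_right_bezout (a b : Matrix n n R) :
    ∃ c u v w z, c = a * u + b * v ∧ a = c * w ∧ b = c * z := by
  obtain ⟨c, u, v, w, z, h₁, h₂, h₃⟩ := exists_left_bezout aᵀ bᵀ
  refine ⟨cᵀ, uᵀ, vᵀ, wᵀ, zᵀ, ?_, ?_, ?_⟩ <;> apply transpose_injective
  · simpa using h₁
  · simpa using h₂
  · simpa using h₃

theorem exists_idempotent_mul_right (a : Matrix n n R) :
    ∃ e : Matrix n n R, e * e = e ∧ a * e = a ∧ ∃ r : R, r ≠ 0 ∧ ∃ w, r • e = w * a := by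
  obtain ⟨e, hee, he, r, hr, hre⟩ := exists_idempotent_rightUnit (Ideal.span {a})
  obtain ⟨w, hw⟩ := Ideal.mem_span_singleton'.1 hre
  exact ⟨e, hee, he a (Ideal.mem_span_singleton_self a), r, hr, w, hw.symm⟩

theorem exists_idempotent_mul_left (a : Matrix n n R) :
    ∃ e : Matrix n n R, e * e = e ∧ e * a = a ∧ ∃ r : R, r ≠ 0 ∧ ∃ w, r • e = a * w := by
  obtain ⟨e, hee, he, r, hr, w, hw⟩ := exists_idempotent_mul_right aᵀ
  refine ⟨eᵀ, ?_, ?_, r, hr, wᵀ, ?_⟩ <;> apply transpose_injective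
  · simpa using hee
  · simpa using he
  · simpa using hw

end Matrix

/-- The ring `D` is the union of an increasing sequence of images of matrix rings over `R`, the
nonzero scalars of which are regular in `D` and belong to finitely generated left ideals only. -/
structure IsMatrixUnion {D R : Type*} [Ring D] [CommRing R] {n : ℕ → Type*} [∀ s, Fintype (n s)]
    [∀ s, DecidableEq (n s)] (ι : ∀ s, Matrix (n s) (n s) R →+* D) : Prop where
  range_le_succ : ∀ s, (ι s).range ≤ (ι (s + 1)).range
  exists_mem_range : ∀ d, ∃ s, d ∈ (ι s).range
  eq_zero_of_scalar_mul : ∀ s r, r ≠ 0 → ∀ d, ι s (Matrix.scalar _ r) * d = 0 → d = 0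
  eq_zero_of_mul_scalar : ∀ s r, r ≠ 0 → ∀ d, d * ι s (Matrix.scalar _ r) = 0 → d = 0
  fg_of_scalar_mem : ∀ s r, r ≠ 0 → ∀ J : Ideal D, ι s (Matrix.scalar _ r) ∈ J → J.FG

namespace IsMatrixUnion

variable {D R : Type*} [Ring D] [CommRing R] {n : ℕ → Type*} [∀ s, Fintype (n s)]
    [∀ s, DecidableEq (n s)] {ι : ∀ s, Matrix (n s) (n s) R →+* D}

theorem monotone_range (h : IsMatrixUnion ι) : Monotone fun s => (ι s).range :=
  monotone_nat_of_le_succ h.range_le_succ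

theorem exists_eq_map_pair (h : IsMatrixUnion ι) (a b : D) : ∃ s α β, a = ι s α ∧ b = ι s β := by
  obtain ⟨s, hs⟩ := h.exists_mem_range a
  obtain ⟨t, ht⟩ := h.exists_mem_range b
  obtain ⟨α, hα⟩ := h.monotone_range (le_max_left s t) hs
  obtain ⟨β, hβ⟩ := h.monotone_range (le_max_right s t) ht
  exact ⟨max s t, α, β, hα.symm, hβ.symm⟩

theorem map_smul_eq_scalar_mul (s : ℕ) (r : R) (e : Matrix (n s) (n s) R) :
    ι s (r • e) = ι s (Matrix.scalar _ r) * ι s e := by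
  rw [← map_mul, Matrix.scalar_apply, ← Matrix.smul_eq_diagonal_mul]

theorem map_smul_eq_mul_scalar (s : ℕ) (r : R) (e : Matrix (n s) (n s) R) :
    ι s (r • e) = ι s e * ι s (Matrix.scalar _ r) := by
  rw [map_smul_eq_scalar_mul, ← map_mul, ← map_mul,
    (Matrix.scalar_commute r (fun _ => mul_comm _ _) e).eq]

variable [IsDomain R] [IsPrincipalIdealRing R]

theorem projective_of_fg (h : IsMatrixUnion ι) (I : Ideal D) (hI : I.FG) :
    Module.Projective D I := by
  refine Ideal.projective_of_fg_of_bezout (fun a b => ?_) (fun a => ?_) I hI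
  · obtain ⟨s, α, β, rfl, rfl⟩ := h.exists_eq_map_pair a b
    obtain ⟨c, u, v, w, z, h₁, h₂, h₃⟩ := Matrix.exists_left_bezout α β
    exact ⟨ι s c, ι s u, ι s v, ι s w, ι s z, by simp [h₁], by rw [← map_mul, ← h₂],
      by rw [← map_mul, ← h₃]⟩
  · obtain ⟨s, α, rfl⟩ := h.exists_mem_range a
    obtain ⟨e, hee, he, r, hr, w, hw⟩ := Matrix.exists_idempotent_mul_left α
    refine ⟨ι s e, by rw [← map_mul, hee], fun b => ⟨fun hb => ?_, fun hb => ?_⟩⟩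
    · refine h.eq_zero_of_mul_scalar s r hr _ ?_
      rw [mul_assoc, ← map_smul_eq_mul_scalar, hw, map_mul, ← mul_assoc, hb, zero_mul]
    · rw [← he, map_mul, ← mul_assoc, hb, zero_mul]

theorem op_projective_of_fg (h : IsMatrixUnion ι) (I : Ideal Dᵐᵒᵖ) (hI : I.FG) :
    Module.Projective Dᵐᵒᵖ I := by
  refine Ideal.projective_of_fg_of_bezout (fun a b => ?_) (fun a => ?_) I hI
  · obtain ⟨s, α, β, hα, hβ⟩ := h.exists_eq_map_pair a.unop b.unop
    obtain ⟨c, u, v, w, z, h₁, h₂, h₃⟩ := Matrix.exists_right_bezout α β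
    refine ⟨.op (ι s c), .op (ι s u), .op (ι s v), .op (ι s w), .op (ι s z), ?_, ?_, ?_⟩ <;>
      apply MulOpposite.unop_injective
    · simp [h₁, hα, hβ]
    · simp [hα, ← map_mul, ← h₂]
    · simp [hβ, ← map_mul, ← h₃]
  · obtain ⟨s, α, hα⟩ := h.exists_mem_range a.unop
    obtain ⟨e, hee, he, r, hr, w, hw⟩ := Matrix.exists_idempotent_mul_right α
    refine ⟨.op (ι s e), by rw [← MulOpposite.op_mul, ← map_mul, hee], fun b => ?_⟩
    rw [← MulOpposite.unop_inj, ← MulOpposite.unop_inj, MulOpposite.unop_mul,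
      MulOpposite.unop_mul, MulOpposite.unop_zero, MulOpposite.unop_op, ← hα]
    refine ⟨fun hb => ?_, fun hb => ?_⟩
    · refine h.eq_zero_of_scalar_mul s r hr _ ?_
      rw [← mul_assoc, ← map_smul_eq_scalar_mul, hw, map_mul, mul_assoc, hb, mul_zero]
    · rw [← he, map_mul, mul_assoc, hb, mul_zero]

theorem projective_ideal (h : IsMatrixUnion ι) (I : Ideal D) : Module.Projective D I := by
  choose e hee he r hr hre using fun s => Matrix.exists_idempotent_rightUnit (I.comap (ι s))
  have hemul : ∀ s, ι s (e s) * ι (s + 1) (e (s + 1)) = ι s (e s) := by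
    intro s
    have h1 : ι s (r s • e s) * ι (s + 1) (e (s + 1)) = ι s (r s • e s) := by
      obtain ⟨β, hβ⟩ := h.range_le_succ s ⟨r s • e s, rfl⟩
      rw [← hβ, ← map_mul, he (s + 1) β]
      rw [Ideal.mem_comap, hβ]
      exact hre s
    rw [map_smul_eq_scalar_mul, mul_assoc, ← sub_eq_zero, ← mul_sub] at h1
    exact sub_eq_zero.1 (h.eq_zero_of_scalar_mul _ _ (hr s) _ h1)
  let u : ℕ → D := fun s => s.casesOn 1 fun s => 1 - ι s (e s)
  have hu : ∀ s d, d * u (s + 1) = 0 ↔ d * ι s (e s) = d := fun s d => by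
    simp only [u, mul_sub, mul_one, sub_eq_zero]
    exact eq_comm
  refine Ideal.projective_of_chain h.projective_of_fg I u (fun s d hd hds => ?_) rfl
    (fun d hd => ?_) (fun s => ?_)
  · cases s with
    | zero => simp [show d = 0 by simpa [u] using hds]
    | succ s =>
      rw [hu] at hds ⊢
      rw [← hds, mul_assoc, hemul]
  · obtain ⟨s, α, rfl⟩ := h.exists_mem_range d
    refine ⟨s + 1, (hu _ _).2 ?_⟩
    rw [← map_mul, he s α hd]
  · cases s with
    | zero =>
      refine ⟨⊥, Submodule.fg_bot, fun d => ?_⟩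
      change d = 0 ↔ d ∈ I ∧ d * 1 = 0
      rw [mul_one]
      exact ⟨fun hd => ⟨hd ▸ zero_mem _, hd⟩, fun hd => hd.2⟩
    | succ s =>
      let f : D →ₗ[D] D := LinearMap.toSpanSingleton D D (ι s (e s))
      have hf : (Submodule.comap f I).FG := by
        refine h.fg_of_scalar_mem s (r s) (hr s) _ ?_
        change ι s (Matrix.scalar _ (r s)) * ι s (e s) ∈ I
        rw [← map_smul_eq_scalar_mul]
        exact hre s
      refine ⟨(Submodule.comap f I).map f, hf.map f, fun d => ?_⟩
      rw [hu]
      constructor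
      · rintro ⟨c, hc, rfl⟩
        refine ⟨hc, ?_⟩
        change c * ι s (e s) * ι s (e s) = c * ι s (e s)
        rw [mul_assoc, ← map_mul, hee]
      · rintro ⟨hd, hde⟩
        refine ⟨d, ?_, hde⟩
        change d * ι s (e s) ∈ I
        rwa [hde]

end IsMatrixUnion

theorem not_isSemisimpleRing_of_mul_ne_one {D : Type*} [Ring D] {x : D}
    (hx : ∀ d, x * d = 0 → d = 0) (hx' : ∀ a, a * x ≠ 1) : ¬ IsSemisimpleRing D := by
  intro h
  obtain ⟨K, hK⟩ := h.exists_isCompl (Ideal.span {x})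
  obtain ⟨y, hy, c, hc, hyc⟩ := Submodule.mem_sup.1
    ((Ideal.eq_top_iff_one _).1 hK.sup_eq_top)
  obtain ⟨a, rfl⟩ := Ideal.mem_span_singleton'.1 hy
  have h0 : x * c = 0 := by
    refine Submodule.disjoint_def.1 hK.disjoint _ ?_ (K.smul_mem _ hc)
    rw [eq_sub_of_add_eq' hyc, mul_sub, mul_one]
    exact sub_mem (Ideal.mem_span_singleton_self _) (Ideal.mul_mem_left _ _ hy)
  rw [hx c h0, add_zero] at hyc
  exact hx' a hyc

section MatrixHom

variable {E S n : Type*} [Ring E] [CommRing S] [Fintype n] [DecidableEq n]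

/-- The ring homomorphism `M ↦ ∑ i j, u i * ε (M i j) * τ * w j`, where `u i * τ * w j` behave as
matrix units over the central scalars `ε`. -/
def matrixHom (u w : n → E) (τ : E) (ε : S →+* E)
    (hτ : ∀ i j, τ * w i * u j * τ = if i = j then τ else 0)
    (hsum : ∑ i, u i * τ * w i = 1) (hετ : ∀ f, Commute (ε f) τ)
    (hεu : ∀ f i, Commute (ε f) (u i)) (hεw : ∀ f i, Commute (ε f) (w i)) :
    Matrix n n S →+* E where
  toFun M := ∑ i, ∑ j, u i * ε (M i j) * τ * w j
  map_one' := by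
    rw [← hsum]
    refine Finset.sum_congr rfl fun i _ => ?_
    rw [Finset.sum_eq_single i] <;> simp +contextual [eq_comm]
  map_zero' := by simp
  map_add' M N := by simp [mul_add, add_mul, Finset.sum_add_distrib]
  map_mul' M N := by
    have key : ∀ i j k l, u i * ε (M i j) * τ * w j * (u k * ε (N k l) * τ * w l) =
        if j = k then u i * ε (M i j * N j l) * τ * w l else 0 := by
      intro i j k l
      have h1 : u k * ε (N k l) * τ = ε (N k l) * (u k * τ) := by
        rw [← (hεu _ _).eq, mul_assoc]
      have h2 : τ * w j * ε (N k l) = ε (N k l) * (τ * w j) := by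
        rw [mul_assoc, ← (hεw _ _).eq, ← mul_assoc, ← (hετ _).eq, mul_assoc]
      calc u i * ε (M i j) * τ * w j * (u k * ε (N k l) * τ * w l)
          = u i * ε (M i j) * (τ * w j * ε (N k l)) * (u k * τ) * w l := by
            rw [h1]; simp only [mul_assoc]
        _ = u i * ε (M i j * N k l) * (τ * w j * u k * τ) * w l := by
            rw [h2, map_mul]; simp only [mul_assoc]
        _ = _ := by
            rw [hτ]
            split_ifs with h
            · rw [h]
            · simp
    simp_rw [Finset.sum_mul, Finset.mul_sum, key]
    refine Finset.sum_congr rfl fun i _ => ?_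
    have collapse : ∀ j, ∑ k, ∑ l, (if j = k then u i * ε (M i j * N j l) * τ * w l else 0) =
        ∑ l, u i * ε (M i j * N j l) * τ * w l := fun j => by
      rw [Finset.sum_comm]
      simp
    simp_rw [collapse]
    rw [Finset.sum_comm]
    simp only [Matrix.mul_apply, map_sum, Finset.mul_sum, Finset.sum_mul]

theorem matrixHom_apply {u w : n → E} {τ : E} {ε : S →+* E}
    {hτ : ∀ i j, τ * w i * u j * τ = if i = j then τ else 0}
    {hsum : ∑ i, u i * τ * w i = 1} {hετ : ∀ f, Commute (ε f) τ}
    {hεu : ∀ f i, Commute (ε f) (u i)} {hεw : ∀ f i, Commute (ε f) (w i)} (M : Matrix n n S) :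
    matrixHom u w τ ε hτ hsum hετ hεu hεw M = ∑ i, ∑ j, u i * ε (M i j) * τ * w j := rfl

theorem matrixHom_scalar {u w : n → E} {τ : E} {ε : S →+* E}
    {hτ : ∀ i j, τ * w i * u j * τ = if i = j then τ else 0}
    {hsum : ∑ i, u i * τ * w i = 1} {hετ : ∀ f, Commute (ε f) τ}
    {hεu : ∀ f i, Commute (ε f) (u i)} {hεw : ∀ f i, Commute (ε f) (w i)} (f : S) :
    matrixHom u w τ ε hτ hsum hετ hεu hεw (Matrix.scalar n f) = ε f := by
  rw [matrixHom_apply, ← mul_one (ε f), ← hsum, Finset.mul_sum]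
  refine Finset.sum_congr rfl fun i _ => ?_
  rw [Finset.sum_eq_single i]
  · simp [← (hεu _ _).eq, mul_assoc]
  · simp +contextual [eq_comm]
  · simp

end MatrixHom

namespace weylAlgebra

open MvPolynomial

section Operators

variable (k : Type*) [Field k]

/-- Multiplication operators as elements of the first Weyl algebra. -/
noncomputable def mulOp : MvPolynomial (Fin 1) k →ₐ[k] weylAlgebra k 1 :=
  (Algebra.lmul k (MvPolynomial (Fin 1) k)).codRestrict (weylAlgebra k 1) fun f => by
    induction f using MvPolynomial.induction_on with
    | C a =>
      rw [← MvPolynomial.algebraMap_eq, AlgHom.commutes]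
      exact (weylAlgebra k 1).algebraMap_mem a
    | add f g hf hg => rw [map_add]; exact add_mem hf hg
    | mul_X f i hf =>
      rw [map_mul]
      exact mul_mem hf (Algebra.subset_adjoin (Or.inl ⟨i, rfl⟩))

variable {k}

theorem monomial_eq_smul (m : Fin 1 →₀ ℕ) (a : k) : monomial m a = a • X 0 ^ m 0 := by
  have hm : m = Finsupp.single 0 (m 0) :=
    Finsupp.ext <| Fin.forall_fin_one.2 Finsupp.single_eq_same.symm
  rw [X_pow_eq_monomial, ← hm, smul_monomial, smul_eq_mul, mul_one]

theorem end_ext {f g : Module.End k (MvPolynomial (Fin 1) k)}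
    (h : ∀ m : ℕ, f (X 0 ^ m) = g (X 0 ^ m)) : f = g := by
  refine (basisMonomials (Fin 1) k).ext fun m => ?_
  simp only [coe_basisMonomials, monomial_eq_smul, one_smul, h]

theorem dividedPower_X_pow (r m : ℕ) :
    dividedPower k 1 0 r (X 0 ^ m) = (m.choose r : k) • X 0 ^ (m - r) := by
  have h : X 0 ^ m = basisMonomials (Fin 1) k (Finsupp.single 0 m) := X_pow_eq_monomial
  rw [h, dividedPower, Module.Basis.constr_basis]
  simp [X_pow_eq_monomial, ← Finsupp.single_tsub]

theorem ext {c d : weylAlgebra k 1}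
    (h : ∀ m : ℕ, (c : Module.End k (MvPolynomial (Fin 1) k)) (X 0 ^ m) =
      (d : Module.End k (MvPolynomial (Fin 1) k)) (X 0 ^ m)) : c = d :=
  Subtype.ext (end_ext h)

theorem eq_zero_of_mulOp_mul {g : MvPolynomial (Fin 1) k} (hg : g ≠ 0) {d : weylAlgebra k 1}
    (h : mulOp k g * d = 0) : d = 0 := by
  refine ext fun m => ?_
  have := LinearMap.congr_fun (congrArg Subtype.val h) (X 0 ^ m)
  exact (mul_eq_zero.1 this).resolve_left hg

variable (k) in
/-- The divided power operators as elements of the first Weyl algebra. -/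
noncomputable def dividedPowerOp (r : ℕ) : weylAlgebra k 1 :=
  ⟨dividedPower k 1 0 r, by
    rcases r.eq_zero_or_pos with rfl | hr
    · have : dividedPower k 1 0 0 = 1 := end_ext fun m => by simp [dividedPower_X_pow]
      rw [this]
      exact one_mem _
    · exact Algebra.subset_adjoin (Or.inr ⟨0, r, hr, rfl⟩)⟩

end Operators

section CharP

variable (k : Type*) [Field k] (p : ℕ) [Fact p.Prime] [CharP k p]

theorem cast_choose_add_pow {s r : ℕ} (hr : r < p ^ s) (m : ℕ) :
    ((m + p ^ s).choose r : k) = m.choose r := by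
  rw [Nat.add_choose_eq, Nat.cast_sum, Finset.sum_eq_single (r, 0)]
  · simp
  · rintro ⟨i, j⟩ hij hne
    rw [Finset.HasAntidiagonal.mem_antidiagonal] at hij
    have hj : j ≠ 0 := by rintro rfl; simp_all
    have : p ∣ (p ^ s).choose j :=
      (Fact.out : p.Prime).dvd_choose_pow hj (by omega)
    simp [(CharP.cast_eq_zero_iff k p _).2 this]
  · simp

theorem cast_choose_add_mul_pow {s r : ℕ} (hr : r < p ^ s) (m a : ℕ) :
    ((m + p ^ s * a).choose r : k) = m.choose r := by
  induction a with
  | zero => rfl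
  | succ a ih => rw [mul_add, mul_one, ← add_assoc, cast_choose_add_pow k p hr, ih]

variable {k}

theorem commute_dividedPower {s r : ℕ} (hr : r < p ^ s) :
    Commute (dividedPower k 1 0 r)
      (Algebra.lmul k (MvPolynomial (Fin 1) k) (X 0 ^ p ^ s)) := by
  rw [commute_iff_eq]
  refine end_ext fun m => ?_
  rw [Module.End.mul_apply, Module.End.mul_apply, Algebra.coe_lmul_eq_mul,
    LinearMap.mul_apply', LinearMap.mul_apply']
  rw [← pow_add, add_comm, dividedPower_X_pow, dividedPower_X_pow, cast_choose_add_pow k p hr]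
  rcases lt_or_ge m r with h | h
  · simp [Nat.choose_eq_zero_of_lt h]
  · rw [mul_smul_comm, ← pow_add, show p ^ s + (m - r) = m + p ^ s - r by omega]

theorem exists_commute (d : weylAlgebra k 1) :
    ∃ s, ∀ t ≥ s, Commute d (mulOp k (X 0 ^ p ^ t)) := by
  suffices h : ∀ d ∈ weylAlgebra k 1, ∃ s, ∀ t ≥ s,
      Commute d (Algebra.lmul k (MvPolynomial (Fin 1) k) (X 0 ^ p ^ t)) by
    obtain ⟨s, hs⟩ := h d d.2
    exact ⟨s, fun t ht => Subtype.ext (hs t ht)⟩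
  intro d hd
  induction hd using Algebra.adjoin_induction with
  | mem d hd =>
    rcases hd with ⟨i, rfl⟩ | ⟨i, r, -, rfl⟩
    · exact ⟨0, fun t _ => (Commute.all (X i) (X 0 ^ p ^ t)).map
        (Algebra.lmul k (MvPolynomial (Fin 1) k))⟩
    · rw [Subsingleton.elim i 0]
      exact ⟨r, fun t ht => commute_dividedPower p
        (ht.trans_lt (Nat.lt_pow_self (Fact.out : p.Prime).one_lt))⟩
  | algebraMap a => exact ⟨0, fun t _ => Algebra.commute_algebraMap_left _ _⟩
  | add c d _ _ hc hd =>
    obtain ⟨s, hs⟩ := hc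
    obtain ⟨t, ht⟩ := hd
    exact ⟨max s t, fun r hr =>
      (hs r (le_trans (le_max_left _ _) hr)).add_left (ht r (le_trans (le_max_right _ _) hr))⟩
  | mul c d _ _ hc hd =>
    obtain ⟨s, hs⟩ := hc
    obtain ⟨t, ht⟩ := hd
    exact ⟨max s t, fun r hr =>
      (hs r (le_trans (le_max_left _ _) hr)).mul_left (ht r (le_trans (le_max_right _ _) hr))⟩

variable {p} in
theorem commute_mulOp_pow {d : weylAlgebra k 1} {s : ℕ}
    (h : Commute d (mulOp k (X 0 ^ p ^ s))) (g : MvPolynomial (Fin 1) k) :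
    Commute d (mulOp k (g ^ p ^ s)) := by
  induction g using MvPolynomial.induction_on with
  | C a =>
    rw [← map_pow, ← MvPolynomial.algebraMap_eq, AlgHom.commutes]
    exact Algebra.commute_algebraMap_right _ _
  | add f g hf hg =>
    rw [add_pow_char_pow, map_add]
    exact hf.add_right hg
  | mul_X f i hf =>
    rw [mul_pow, map_mul, Subsingleton.elim i 0]
    exact hf.mul_right h

theorem eq_zero_of_mul_mulOp (p : ℕ) [Fact p.Prime] [CharP k p] {g : MvPolynomial (Fin 1) k} (hg : g ≠ 0) {d : weylAlgebra k 1}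
    (h : d * mulOp k g = 0) : d = 0 := by
  obtain ⟨s, hs⟩ := exists_commute p d
  refine eq_zero_of_mulOp_mul (pow_ne_zero (p ^ s) hg) ?_
  rw [← (commute_mulOp_pow (hs s le_rfl) g).eq, map_pow,
    ← Nat.sub_add_cancel (Nat.one_le_pow s p (Fact.out : p.Prime).pos), pow_succ', ← mul_assoc,
    h, zero_mul]

theorem not_isSemisimpleRing (p : ℕ) [Fact p.Prime] [CharP k p] : ¬ IsSemisimpleRing (weylAlgebra k 1) := by
  refine not_isSemisimpleRing_of_mul_ne_one (fun d => eq_zero_of_mulOp_mul (X_ne_zero 0))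
    fun a hyc => ?_
  obtain ⟨s, hs⟩ := exists_commute p a
  have h1 : mulOp k (X 0 ^ p ^ s) * a = mulOp k (X 0 ^ (p ^ s - 1)) := by
    rw [← (hs s le_rfl).eq, map_pow,
      ← Nat.sub_add_cancel (Nat.one_le_pow s p (Fact.out : p.Prime).pos), pow_succ', ← mul_assoc,
      hyc, one_mul, ← map_pow, Nat.add_sub_cancel]
  have h2 := LinearMap.congr_fun (congrArg Subtype.val h1) 1
  change X 0 ^ p ^ s * (a : Module.End k (MvPolynomial (Fin 1) k)) 1 = X 0 ^ (p ^ s - 1) * 1 at h2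
  rw [← Nat.sub_add_cancel (Nat.one_le_pow s p (Fact.out : p.Prime).pos), pow_succ, mul_assoc,
    Nat.add_sub_cancel] at h2
  have h3 := mul_left_cancel₀ (pow_ne_zero _ (X_ne_zero 0)) h2
  have h4 := congrArg constantCoeff h3
  simp at h4

end CharP

end weylAlgebra

section FG

variable {k D A : Type*} [Field k] [Ring D] [Algebra k D] [CommRing A] [Algebra k A]

theorem Submodule.exists_finite_subset_le_span_sup {I V : Submodule k A} [IsNoetherian k (A ⧸ I)] :
    ∃ T : Set A, T.Finite ∧ T ⊆ V ∧ V ≤ Submodule.span k T ⊔ I := by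
  obtain ⟨S, hS, hSV⟩ := Submodule.fg_def.1 (IsNoetherian.noetherian (V.map I.mkQ))
  have hS' : S ⊆ I.mkQ '' V := fun y hy => by
    have : y ∈ V.map I.mkQ := hSV ▸ Submodule.subset_span hy
    exact this
  obtain ⟨T, hTV, hT, hTS⟩ := Set.exists_subset_image_finite_and.1
    ⟨S, hS', hS, rfl⟩
  refine ⟨T, hT, hTV, ?_⟩
  have := (LinearMap.map_le_map_iff I.mkQ (p := V) (p' := Submodule.span k T)).1 ?_
  · rwa [Submodule.ker_mkQ] at this
  · rw [Submodule.map_span, ← hSV, ← hTS]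

/-- A left ideal containing the image of an element `g` of finite codimension is finitely generated
as soon as every element of the ring generates the same left ideal as finitely many products
`τ s * m h`, for all large `s`. -/
theorem Ideal.fg_of_map_mem (m : A →ₐ[k] D) (τ : ℕ → D)
    (hτ : ∀ s t, s ≤ t → ∃ θ, τ t = θ * τ s)
    (hspan : ∀ d, ∃ s, ∀ t ≥ s, d ∈ Ideal.span {e | e ∈ Ideal.span {d} ∧ ∃ h, e = τ t * m h})
    (g : A) [IsNoetherian k (A ⧸ (Ideal.span {g}).restrictScalars k)] (J : Ideal D)
    (hg : m g ∈ J) : J.FG := by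
  let V : ℕ → Submodule k A := fun s =>
    (J.restrictScalars k).comap ((LinearMap.mulLeft k (τ s)).comp m.toLinearMap)
  have mem_V : ∀ s c, c ∈ V s ↔ τ s * m c ∈ J := fun s c => Iff.rfl
  have hV : Monotone V := fun s t hst c hc => by
    obtain ⟨θ, hθ⟩ := hτ s t hst
    rw [mem_V, hθ, mul_assoc]
    exact J.mul_mem_left _ hc
  have hIV : ∀ s, (Ideal.span {g}).restrictScalars k ≤ V s := fun s c hc => by
    obtain ⟨f, rfl⟩ := Ideal.mem_span_singleton'.1 ((Submodule.restrictScalars_mem k _ _).1 hc)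
    rw [mem_V, map_mul, ← mul_assoc]
    exact J.mul_mem_left _ hg
  obtain ⟨N, hN⟩ := monotone_stabilizes_iff_noetherian.2
    (inferInstanceAs (IsNoetherian k (A ⧸ (Ideal.span {g}).restrictScalars k)))
    ⟨fun s => (V s).map ((Ideal.span {g}).restrictScalars k).mkQ,
      fun s t hst => Submodule.map_mono (hV hst)⟩
  have hVN : ∀ s ≥ N, V s ≤ V N := fun s hs => by
    have := (LinearMap.map_le_map_iff _).1 (hN s hs).ge
    rwa [Submodule.ker_mkQ, sup_eq_left.2 (hIV N)] at this
  obtain ⟨T, hT, hTV, hVT⟩ := Submodule.exists_finite_subset_le_span_sup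
    (I := (Ideal.span {g}).restrictScalars k) (V := V N)
  let J' : Ideal D := Ideal.span (insert (m g) ((fun c => τ N * m c) '' T))
  suffices h : J = J' from h ▸ Submodule.fg_span ((hT.image _).insert _)
  refine le_antisymm (fun d hd => ?_) (Ideal.span_le.2 (Set.insert_subset hg ?_))
  · obtain ⟨s, hs⟩ := hspan d
    refine Ideal.span_le.2 ?_ (hs (max s N) (le_max_left _ _))
    rintro _ ⟨he, h, rfl⟩
    have hh : h ∈ V N := hVN (max s N) (le_max_right _ _)
      ((mem_V _ _).2 ((Ideal.span_singleton_le_iff_mem J).2 hd he))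
    obtain ⟨θ, hθ⟩ := hτ N (max s N) (le_max_right _ _)
    obtain ⟨c, hc, r, hr, rfl⟩ := Submodule.mem_sup.1 (hVT hh)
    rw [map_add, mul_add]
    refine J'.add_mem ?_ ?_
    · rw [hθ, mul_assoc]
      refine J'.mul_mem_left _ ?_
      have : Submodule.span k T ≤ (J'.restrictScalars k).comap
          ((LinearMap.mulLeft k (τ N)).comp m.toLinearMap) :=
        Submodule.span_le.2 fun c hc => Ideal.subset_span (Or.inr ⟨c, hc, rfl⟩)
      exact this hc
    · obtain ⟨f, rfl⟩ := Ideal.mem_span_singleton'.1 ((Submodule.restrictScalars_mem k _ _).1 hr)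
      rw [map_mul, ← mul_assoc]
      exact J'.mul_mem_left _ (Ideal.subset_span (Set.mem_insert _ _))
  · rintro _ ⟨c, hc, rfl⟩
    exact hTV hc

end FG

open Polynomial in
/-- The relations between the variable `x` and the top divided powers `τ s` of order `q s - 1` that
exhibit a ring as the union of the centralizers of the `x ^ q s`, each of which is a matrix ring
over the polynomials in `x ^ q s`. -/
structure IsDividedPowerTower (k : Type*) {D : Type*} [Field k] [Ring D] [Algebra k D] (x : D)
    (q : ℕ → ℕ) (τ : ℕ → D) : Prop where
  pos : ∀ s, 0 < q s
  dvd_succ : ∀ s, q s ∣ q (s + 1)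
  commute : ∀ s, Commute (τ s) (x ^ q s)
  mul_mul : ∀ s i j, i < q s → j < q s →
    τ s * x ^ (q s - 1 - i) * x ^ j * τ s = if i = j then τ s else 0
  sum_eq_one : ∀ s, ∑ i : Fin (q s), x ^ (i : ℕ) * τ s * x ^ (q s - 1 - i) = 1
  exists_commute : ∀ d, ∃ s, ∀ t ≥ s, Commute d (x ^ q t)
  exists_aeval : ∀ s d, Commute d (x ^ q s) → ∃ f : k[X], τ s * d * τ s = aeval (x ^ q s) f * τ s
  exists_mul : ∀ s t, s ≤ t → ∃ θ, τ t = θ * τ s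
  eq_zero_of_aeval_mul : ∀ f : k[X], f ≠ 0 → ∀ d, aeval x f * d = 0 → d = 0
  eq_zero_of_mul_aeval : ∀ f : k[X], f ≠ 0 → ∀ d, d * aeval x f = 0 → d = 0

theorem Commute.aeval_left {k D : Type*} [CommSemiring k] [Semiring D] [Algebra k D] {a d : D}
    (h : Commute a d) (f : Polynomial k) : Commute (Polynomial.aeval a f) d := by
  induction f using Polynomial.induction_on' with
  | add f g hf hg => rw [map_add]; exact hf.add_left hg
  | monomial n r =>
    rw [Polynomial.aeval_monomial]
    exact (Algebra.commute_algebraMap_left r d).mul_left (h.pow_left n)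

theorem Polynomial.isNoetherian_quotient_span_singleton {k : Type*} [Field k] {g : Polynomial k}
    (hg : g ≠ 0) :
    IsNoetherian k (Polynomial k ⧸ (Ideal.span {g}).restrictScalars k) := by
  have : Module.Finite k (AdjoinRoot g) := (AdjoinRoot.powerBasis hg).finite
  exact isNoetherian_of_isNoetherianRing_of_finite k (AdjoinRoot g)

namespace IsDividedPowerTower

open Polynomial

variable {k D : Type*} [Field k] [Ring D] [Algebra k D] {x : D} {q : ℕ → ℕ} {τ : ℕ → D}

/-- The identification of matrices over the polynomial ring with the centralizer of `x ^ q s`. -/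
noncomputable def matrixHom (h : IsDividedPowerTower k x q τ) (s : ℕ) :
    Matrix (Fin (q s)) (Fin (q s)) k[X] →+* D :=
  _root_.matrixHom (fun i => x ^ (i : ℕ)) (fun i => x ^ (q s - 1 - i)) (τ s)
    (aeval (x ^ q s) : k[X] →ₐ[k] D).toRingHom
    (fun i j => by simpa [Fin.ext_iff] using h.mul_mul s i j i.2 j.2) (h.sum_eq_one s)
    (fun f => (h.commute s).symm.aeval_left f)
    (fun f i => (Commute.pow_pow_self x _ _).aeval_left f)
    (fun f i => (Commute.pow_pow_self x _ _).aeval_left f)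

theorem matrixHom_scalar (h : IsDividedPowerTower k x q τ) (s : ℕ) (f : k[X]) :
    h.matrixHom s (Matrix.scalar _ f) = aeval x (expand k (q s) f) := by
  rw [expand_aeval]
  exact _root_.matrixHom_scalar f

theorem exists_mul_pow_mul (h : IsDividedPowerTower k x q τ) {s : ℕ} {d : D} (hd : Commute d (x ^ q s)) (i : Fin (q s)) :
    ∃ f : Fin (q s) → k[X], τ s * x ^ (q s - 1 - i) * d =
      ∑ j : Fin (q s), aeval (x ^ q s) (f j) * τ s * x ^ (q s - 1 - j) := by
  choose f hf using fun j : Fin (q s) => h.exists_aeval s (x ^ (q s - 1 - i) * d * x ^ (j : ℕ))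
    (((Commute.pow_pow_self x _ _).mul_left hd).mul_left (Commute.pow_pow_self x _ _))
  refine ⟨f, ?_⟩
  conv_lhs => rw [← mul_one d, ← h.sum_eq_one s, Finset.mul_sum, Finset.mul_sum]
  refine Finset.sum_congr rfl fun j _ => ?_
  rw [← hf]
  simp only [mul_assoc]

theorem mem_range_matrixHom (h : IsDividedPowerTower k x q τ) {s : ℕ} {d : D} :
    d ∈ (h.matrixHom s).range ↔ Commute d (x ^ q s) := by
  constructor
  · rintro ⟨M, rfl⟩
    have := (Matrix.scalar_commute (X : k[X]) (fun _ => mul_comm _ _) M).symm.map (h.matrixHom s)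
    rwa [h.matrixHom_scalar, expand_aeval, aeval_X] at this
  · intro hd
    choose f hf using h.exists_mul_pow_mul hd
    refine ⟨Matrix.of f, ?_⟩
    conv_rhs => rw [← one_mul d, ← h.sum_eq_one s, Finset.sum_mul]
    refine (matrixHom_apply _).trans (Finset.sum_congr rfl fun i _ => ?_)
    rw [mul_assoc, mul_assoc, ← mul_assoc (τ s), hf, Finset.mul_sum]
    simp only [mul_assoc]
    rfl

theorem mem_span_mul_aeval (h : IsDividedPowerTower k x q τ) {s : ℕ} {d : D} (hd : Commute d (x ^ q s)) :
    d ∈ Ideal.span {e | e ∈ Ideal.span {d} ∧ ∃ f : k[X], e = τ s * aeval x f} := by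
  have hsum : ∑ i : Fin (q s), x ^ (i : ℕ) * (τ s * x ^ (q s - 1 - i) * d) = d := by
    conv_rhs => rw [← one_mul d, ← h.sum_eq_one s, Finset.sum_mul]
    simp only [mul_assoc]
  refine (congrArg (· ∈ Ideal.span _) hsum).mp ?_
  refine Ideal.sum_mem _ fun i _ => Ideal.mul_mem_left _ _ (Ideal.subset_span ?_)
  refine ⟨Ideal.mul_mem_left _ _ (Ideal.mem_span_singleton_self d), ?_⟩
  obtain ⟨f, hf⟩ := h.exists_mul_pow_mul hd i
  refine ⟨∑ j : Fin (q s), expand k (q s) (f j) * X ^ (q s - 1 - j), ?_⟩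
  rw [hf, map_sum, Finset.mul_sum]
  refine Finset.sum_congr rfl fun j _ => ?_
  rw [map_mul, expand_aeval, map_pow, aeval_X, ((h.commute s).symm.aeval_left (f j)).eq, mul_assoc]

theorem isMatrixUnion (h : IsDividedPowerTower k x q τ) : IsMatrixUnion h.matrixHom where
  range_le_succ s d hd := by
    obtain ⟨r, hr⟩ := h.dvd_succ s
    rw [mem_range_matrixHom] at hd ⊢
    rw [hr, pow_mul]
    exact hd.pow_right r
  exists_mem_range d := by
    obtain ⟨s, hs⟩ := h.exists_commute d
    exact ⟨s, h.mem_range_matrixHom.2 (hs s le_rfl)⟩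
  eq_zero_of_scalar_mul s f hf d := by
    rw [matrixHom_scalar]
    exact h.eq_zero_of_aeval_mul _ (mt (expand_eq_zero (h.pos s)).1 hf) d
  eq_zero_of_mul_scalar s f hf d := by
    rw [matrixHom_scalar]
    exact h.eq_zero_of_mul_aeval _ (mt (expand_eq_zero (h.pos s)).1 hf) d
  fg_of_scalar_mem s f hf J hJ := by
    rw [matrixHom_scalar] at hJ
    have := isNoetherian_quotient_span_singleton (mt (expand_eq_zero (h.pos s)).1 hf)
    refine Ideal.fg_of_map_mem (aeval x) τ h.exists_mul (fun d => ?_) _ J hJ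
    obtain ⟨t, ht⟩ := h.exists_commute d
    exact ⟨t, fun r hr => h.mem_span_mul_aeval (ht r hr)⟩

end IsDividedPowerTower

theorem Nat.dvd_iff_eq_of_add_eq {q i j a b : ℕ} (hi : i < q) (hj : j < q) (h : a + i = b + j)
    (hb : q ∣ b) : q ∣ a ↔ i = j := by
  constructor
  · intro ha
    obtain ⟨c, rfl⟩ := ha
    obtain ⟨d, rfl⟩ := hb
    have := congrArg (· % q) h
    simpa [Nat.mul_add_mod, Nat.mod_eq_of_lt hi, Nat.mod_eq_of_lt hj] using this
  · rintro rfl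
    rwa [Nat.add_right_cancel h]

namespace weylAlgebra

open MvPolynomial

variable (k : Type*) [Field k] (p : ℕ) [Fact p.Prime] [CharP k p]

/-- The divided power operator of order `p ^ s - 1`. -/
noncomputable def topDividedPower (s : ℕ) : weylAlgebra k 1 :=
  dividedPowerOp k (p ^ s - 1)

theorem topDividedPower_X_pow (s m : ℕ) :
    (topDividedPower k p s).1 (X 0 ^ m) =
      if p ^ s ∣ m + 1 then X 0 ^ (m + 1 - p ^ s) else 0 := by
  have hq : 0 < p ^ s := Nat.pow_pos (Fact.out : p.Prime).pos
  refine (dividedPower_X_pow _ _).trans ?_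
  have hm := Nat.mod_add_div m (p ^ s)
  have hlt := Nat.mod_lt m hq
  have hdvd : p ^ s ∣ m + 1 ↔ p ^ s - 1 = m % p ^ s :=
    Nat.dvd_iff_eq_of_add_eq (b := p ^ s * (m / p ^ s + 1)) (by omega) hlt
      (by rw [mul_add]; omega) (dvd_mul_right _ _)
  rw [show (m.choose (p ^ s - 1) : k) = (m % p ^ s).choose (p ^ s - 1) by
    conv_lhs => rw [← hm]
    exact cast_choose_add_mul_pow k p (by omega) _ _]
  split_ifs with h
  · rw [← hdvd.1 h, Nat.choose_self, Nat.cast_one, one_smul]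
    congr 1
    omega
  · rw [Nat.choose_eq_zero_of_lt (by have := mt hdvd.2 h; omega), Nat.cast_zero, zero_smul]

theorem commute_topDividedPower (s : ℕ) :
    Commute (topDividedPower k p s) (mulOp k (X 0 ^ p ^ s)) :=
  Subtype.ext (commute_dividedPower p
    (Nat.sub_lt (Nat.pow_pos (Fact.out : p.Prime).pos) one_pos)).eq

variable {k p}

theorem apply_X_pow_mul {d : weylAlgebra k 1} {q : ℕ} (h : Commute d (mulOp k (X 0 ^ q))) (a : ℕ)
    (g : MvPolynomial (Fin 1) k) : d.1 (X 0 ^ (q * a) * g) = X 0 ^ (q * a) * d.1 g := by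
  have := h.pow_right a
  rw [← map_pow, ← pow_mul] at this
  exact LinearMap.congr_fun (congrArg Subtype.val this.eq) g

theorem exists_topDividedPower_eq_aeval (s : ℕ) (g : MvPolynomial (Fin 1) k) :
    ∃ f : Polynomial k, (topDividedPower k p s).1 g = Polynomial.aeval (X 0 ^ p ^ s) f := by
  induction g using MvPolynomial.induction_on' with
  | monomial m a =>
    rw [monomial_eq_smul, map_smul, topDividedPower_X_pow]
    split_ifs with h
    · obtain ⟨c, hc⟩ := h
      refine ⟨a • Polynomial.X ^ (c - 1), ?_⟩
      rw [map_smul, map_pow, Polynomial.aeval_X, hc, ← pow_mul, Nat.mul_sub, mul_one]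
    · exact ⟨0, by simp⟩
  | add f g hf hg =>
    obtain ⟨a, ha⟩ := hf
    obtain ⟨b, hb⟩ := hg
    exact ⟨a + b, by rw [map_add, map_add, ha, hb]⟩

theorem aeval_mulOp (g : MvPolynomial (Fin 1) k) (f : Polynomial k) :
    Polynomial.aeval (mulOp k g) f = mulOp k (Polynomial.aeval g f) :=
  Polynomial.aeval_algHom_apply _ _ _

theorem aeval_X_ne_zero {f : Polynomial k} (hf : f ≠ 0) :
    Polynomial.aeval (X 0 : MvPolynomial (Fin 1) k) f ≠ 0 :=
  fun h => hf ((transcendental_iff.1 (transcendental_X k 0)) f h)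

variable (k p)

theorem isDividedPowerTower :
    IsDividedPowerTower k (mulOp k (X 0)) (fun s => p ^ s) (topDividedPower k p) where
  pos s := Nat.pow_pos (Fact.out : p.Prime).pos
  dvd_succ s := pow_dvd_pow p s.le_succ
  commute s := by
    rw [← map_pow]
    exact commute_topDividedPower k p s
  mul_mul s i j hi hj := by
    simp only [← map_pow]
    refine ext fun m => ?_
    trans (topDividedPower k p s).1 (X 0 ^ (p ^ s - 1 - i) * (X 0 ^ j *
      (topDividedPower k p s).1 (X 0 ^ m)))
    · rfl
    rw [topDividedPower_X_pow k p s m]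
    by_cases h : p ^ s ∣ m + 1
    · have hle := Nat.le_of_dvd m.succ_pos h
      rw [if_pos h, ← pow_add, ← pow_add, topDividedPower_X_pow]
      by_cases hij : i = j
      · rw [if_pos hij, if_pos ((Nat.dvd_iff_eq_of_add_eq hi hj (by omega) h).2 hij),
          topDividedPower_X_pow, if_pos h]
        congr 1
        omega
      · rw [if_neg hij, if_neg (mt (Nat.dvd_iff_eq_of_add_eq hi hj (by omega) h).1 hij)]
        rfl
    · rw [if_neg h, mul_zero, mul_zero, map_zero]
      split_ifs
      · rw [topDividedPower_X_pow, if_neg h]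
      · rfl
  sum_eq_one s := by
    simp only [← map_pow]
    refine ext fun m => ?_
    have hm := Nat.mod_add_div m (p ^ s)
    have hlt := Nat.mod_lt m (Nat.pow_pos (n := s) (Fact.out : p.Prime).pos)
    have hterm : ∀ i : Fin (p ^ s), (mulOp k (X 0 ^ (i : ℕ)) * topDividedPower k p s *
        mulOp k (X 0 ^ (p ^ s - 1 - i))).1 (X 0 ^ m) =
          if (i : ℕ) = m % p ^ s then X 0 ^ m else 0 := fun i => by
      trans X 0 ^ (i : ℕ) * (topDividedPower k p s).1 (X 0 ^ (p ^ s - 1 - i) * X 0 ^ m)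
      · rfl
      have hdvd := Nat.dvd_iff_eq_of_add_eq (a := p ^ s - 1 - i + m + 1)
        (b := p ^ s * (m / p ^ s + 1)) i.2 hlt (by rw [mul_add]; omega) (dvd_mul_right _ _)
      rw [← pow_add, topDividedPower_X_pow]
      by_cases hi : (i : ℕ) = m % p ^ s
      · rw [if_pos hi, if_pos (hdvd.2 hi), ← pow_add]
        congr 1
        have := Nat.le_of_dvd (Nat.succ_pos _) (hdvd.2 hi)
        omega
      · rw [if_neg hi, if_neg (mt hdvd.1 hi), mul_zero]
    rw [AddSubmonoidClass.coe_finsetSum, LinearMap.sum_apply]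
    refine (Finset.sum_congr rfl fun i _ => hterm i).trans ?_
    rw [Finset.sum_eq_single (⟨m % p ^ s, hlt⟩ : Fin (p ^ s))]
    · exact if_pos rfl
    · exact fun i _ hi => if_neg fun h => hi (Fin.ext h)
    · exact fun h => (h (Finset.mem_univ _)).elim
  exists_commute d := by
    obtain ⟨s, hs⟩ := exists_commute p d
    exact ⟨s, fun t ht => by rw [← map_pow]; exact hs t ht⟩
  exists_aeval s d hd := by
    rw [← map_pow] at hd ⊢
    obtain ⟨f, hf⟩ := exists_topDividedPower_eq_aeval (p := p) s (d.1 1)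
    refine ⟨f, ext fun m => ?_⟩
    rw [aeval_mulOp, ← hf]
    trans (topDividedPower k p s).1 (d.1 ((topDividedPower k p s).1 (X 0 ^ m)))
    · rfl
    trans (topDividedPower k p s).1 (d.1 1) * (topDividedPower k p s).1 (X 0 ^ m)
    swap
    · rfl
    rw [topDividedPower_X_pow k p s m]
    split_ifs with h
    · obtain ⟨c, hc⟩ := h
      rw [hc, show p ^ s * c - p ^ s = p ^ s * (c - 1) by rw [Nat.mul_sub, mul_one],
        ← mul_one (X 0 ^ _), apply_X_pow_mul hd, apply_X_pow_mul (commute_topDividedPower k p s),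
        mul_one, mul_comm]
    · simp
  exists_mul s t hst := by
    refine ⟨topDividedPower k p t * mulOp k (X 0 ^ (p ^ s - 1)), ext fun m => ?_⟩
    trans (topDividedPower k p t).1 (X 0 ^ (p ^ s - 1) * (topDividedPower k p s).1 (X 0 ^ m))
    swap
    · rfl
    rw [topDividedPower_X_pow k p s m]
    split_ifs with h
    · have := Nat.le_of_dvd m.succ_pos h
      have := Nat.pow_pos (n := s) (Fact.out : p.Prime).pos
      rw [← pow_add, show p ^ s - 1 + (m + 1 - p ^ s) = m by omega]
    · rw [mul_zero, map_zero, topDividedPower_X_pow,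
        if_neg fun h' => h ((pow_dvd_pow p hst).trans h')]
  eq_zero_of_aeval_mul f hf d := by
    rw [aeval_mulOp]
    exact eq_zero_of_mulOp_mul (aeval_X_ne_zero hf)
  eq_zero_of_mul_aeval f hf d := by
    rw [aeval_mulOp]
    exact eq_zero_of_mul_mulOp p (aeval_X_ne_zero hf)

end weylAlgebra

theorem IsLeftCoherent.of_projective {R : Type*} [Ring R]
    (h : ∀ I : Ideal R, I.FG → Module.Projective R I) : IsLeftCoherent R := fun I hI => by
  have := h I hI
  have : Module.Finite R I := Module.Finite.iff_fg.2 hI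
  exact Module.finitePresentation_of_projective R I

theorem IsRightCoherent.of_projective {R : Type*} [Ring R]
    (h : ∀ I : Ideal Rᵐᵒᵖ, I.FG → Module.Projective Rᵐᵒᵖ I) : IsRightCoherent R :=
  IsLeftCoherent.of_projective h

universe u in
set_option synthInstance.maxHeartbeats 1000000 in
set_option maxHeartbeats 1000000 in
/-- In characteristic `p > 0`, the first Weyl algebra `A_1(k)` has left global dimension one:
it is not semisimple, and every submodule of a projective left module is projective. In
particular it is left semi-hereditary (every finitely generated left ideal is projective) and
hence a coherent ring. -/
theorem weylAlgebra_one_globalDimension_one (k : Type*) [Field k] (p : ℕ) (hp : 0 < p)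
    [CharP k p] :
    (¬ IsSemisimpleRing (weylAlgebra k 1) ∧
      ∀ (M : Type u) [AddCommGroup M] [Module (weylAlgebra k 1) M]
        (N : Submodule (weylAlgebra k 1) M),
          Module.Projective (weylAlgebra k 1) M → Module.Projective (weylAlgebra k 1) N) ∧
    (∀ I : Ideal (weylAlgebra k 1), I.FG → Module.Projective (weylAlgebra k 1) I) ∧
    IsLeftCoherent (weylAlgebra k 1) ∧ IsRightCoherent (weylAlgebra k 1) := by
  have : Fact p.Prime := ⟨(CharP.char_is_prime_or_zero k p).resolve_right hp.ne'⟩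
  have h := (weylAlgebra.isDividedPowerTower k p).isMatrixUnion
  exact ⟨⟨weylAlgebra.not_isSemisimpleRing p, fun M _ _ N _ =>
      Submodule.projective_of_projective_ideals h.projective_ideal N⟩,
    fun I _ => h.projective_ideal I, .of_projective h.projective_of_fg, .of_projective h.op_projective_of_fg⟩
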